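/- Let D be a commutative monoid and (A d)_{d ∈ D} a dimensioned ring over D. A derivation of A of dimension k ∈ D is a family of additive maps Δ : A d → A (k*d) satisfying the Leibniz identity Δ(a*b) = Δ(a)*b + a*Δ(b) up to canonical transport along index equalities in D. Then for any derivation Δ of dimension k and any derivation Δ' of dimension k', the commutator [Δ, Δ'] := Δ ∘ Δ' − Δ' ∘ Δ, where the two compositions are identified via the canonical transport along k*(k'*d) = k'*(k*d), is again a family of additive maps A d → A (k*k'*d) satisfying the Leibniz identity; i.e. the commutator of two derivations of a dimensioned ring is a derivation of dimension k*k'. -/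

import Mathlib

universe u v

/-- Canonical transport of elements of a type family along an equality of indices. -/
def dcast {D : Type u} (A : D → Type v) {d e : D} (h : d = e) : A d → A e :=
  fun a => cast (congrArg A h) a

/-- A dimensioned (commutative, unital) ring over a commutative monoid `D` of dimensions. -/
structure DimRingOn {D : Type u} [CommMonoid D] (A : D → Type v)
    [∀ d, AddCommGroup (A d)] where
  mul : ∀ {d e : D}, A d → A e → A (d * e)
  one : A 1
  mul_add : ∀ {d e : D} (a : A d) (b c : A e), mul a (b + c) = mul a b + mul a c
  add_mul : ∀ {d e : D} (a b : A d) (c : A e), mul (a + b) c = mul a c + mul b c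
  mul_assoc' : ∀ {d e f : D} (a : A d) (b : A e) (c : A f),
    dcast A (mul_assoc d e f) (mul (mul a b) c) = mul a (mul b c)
  mul_comm' : ∀ {d e : D} (a : A d) (b : A e),
    dcast A (mul_comm d e) (mul a b) = mul b a
  one_mul' : ∀ {d : D} (a : A d), dcast A (one_mul d) (mul one a) = a

theorem dim_comm_eq {D : Type u} [CommMonoid D] (k k' d : D) :
    k' * (k * d) = k * k' * d := by ac_rfl

/-- The commutator `[Δ, Δ'] = Δ ∘ Δ' - Δ' ∘ Δ` of two families of maps `Δ : A d → A (k * d)`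
and `Δ' : A d → A (k' * d)`, the compositions being identified via canonical transport,
regarded as a family of maps `A d → A (k * k' * d)`. -/
def dimDerComm {D : Type u} [CommMonoid D] (A : D → Type v) [∀ d, AddCommGroup (A d)]
    (k k' : D) (Δ : ∀ d : D, A d → A (k * d)) (Δ' : ∀ d : D, A d → A (k' * d))
    (d : D) (a : A d) : A (k * k' * d) :=
  dcast A (mul_assoc k k' d).symm (Δ (k' * d) (Δ' d a))
    - dcast A (dim_comm_eq k k' d) (Δ' (k * d) (Δ d a))

section Transport

variable {D : Type u} {A : D → Type v}

theorem dcast_dcast {d e f : D} (h : d = e) (h' : e = f) (a : A d) :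
    dcast A h' (dcast A h a) = dcast A (h.trans h') a := by
  subst h h'; rfl

theorem dcast_add [∀ d, AddCommGroup (A d)] {d e : D} (h : d = e) (a b : A d) :
    dcast A h (a + b) = dcast A h a + dcast A h b := by
  subst h; rfl

theorem dcast_sub [∀ d, AddCommGroup (A d)] {d e : D} (h : d = e) (a b : A d) :
    dcast A h (a - b) = dcast A h a - dcast A h b := by
  subst h; rfl

theorem map_dcast {σ : D → D} (F : ∀ d, A d → A (σ d)) {d e : D} (h : d = e) (a : A d) :
    F e (dcast A h a) = dcast A (congrArg σ h) (F d a) := by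
  subst h; rfl

variable [CommMonoid D] [∀ d, AddCommGroup (A d)] (R : DimRingOn A)

theorem DimRingOn.dcast_mul {d d' e : D} (h : d = d') (a : A d) (b : A e) :
    R.mul (dcast A h a) b = dcast A (congrArg (· * e) h) (R.mul a b) := by
  subst h; rfl

theorem DimRingOn.mul_dcast {d e e' : D} (h : e = e') (a : A d) (b : A e) :
    R.mul a (dcast A h b) = dcast A (congrArg (d * ·) h) (R.mul a b) := by
  subst h; rfl

theorem DimRingOn.sub_mul {d e : D} (a b : A d) (c : A e) :
    R.mul (a - b) c = R.mul a c - R.mul b c := by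
  rw [eq_sub_iff_add_eq, ← R.add_mul, sub_add_cancel]

theorem DimRingOn.mul_sub {d e : D} (a : A d) (b c : A e) :
    R.mul a (b - c) = R.mul a b - R.mul a c := by
  rw [eq_sub_iff_add_eq, ← R.mul_add, sub_add_cancel]

end Transport

/-- Let `A` be a dimensioned ring over a commutative monoid `D`. A
derivation of dimension `k` is a family of additive maps `Δ : A d → A (k * d)` satisfying
the Leibniz identity `Δ(a * b) = Δ(a) * b + a * Δ(b)` up to canonical transport. Then the
commutator `[Δ, Δ'] = Δ ∘ Δ' - Δ' ∘ Δ` of a derivation `Δ` of dimension `k` and a derivation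
`Δ'` of dimension `k'` is again a family of additive maps satisfying the Leibniz identity,
i.e. a derivation of dimension `k * k'`. -/
theorem dimensioned_derivation_commutator {D : Type u} [CommMonoid D]
    (A : D → Type v) [∀ d, AddCommGroup (A d)] (R : DimRingOn A) (k k' : D)
    (Δ : ∀ d : D, A d → A (k * d)) (Δ' : ∀ d : D, A d → A (k' * d))
    (hΔadd : ∀ (d : D) (a b : A d), Δ d (a + b) = Δ d a + Δ d b)
    (hΔ'add : ∀ (d : D) (a b : A d), Δ' d (a + b) = Δ' d a + Δ' d b)
    (hΔleib : ∀ (d e : D) (a : A d) (b : A e),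
      Δ (d * e) (R.mul a b)
        = dcast A (mul_assoc k d e) (R.mul (Δ d a) b)
          + dcast A (mul_left_comm d k e) (R.mul a (Δ e b)))
    (hΔ'leib : ∀ (d e : D) (a : A d) (b : A e),
      Δ' (d * e) (R.mul a b)
        = dcast A (mul_assoc k' d e) (R.mul (Δ' d a) b)
          + dcast A (mul_left_comm d k' e) (R.mul a (Δ' e b))) :
    -- the commutator is a family of additive maps:
    (∀ (d : D) (a b : A d),
      dimDerComm A k k' Δ Δ' d (a + b)
        = dimDerComm A k k' Δ Δ' d a + dimDerComm A k k' Δ Δ' d b) ∧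
    -- satisfying the Leibniz identity of dimension `k * k'`:
    (∀ (d e : D) (a : A d) (b : A e),
      dimDerComm A k k' Δ Δ' (d * e) (R.mul a b)
        = dcast A (mul_assoc (k * k') d e) (R.mul (dimDerComm A k k' Δ Δ' d a) b)
          + dcast A (mul_left_comm d (k * k') e) (R.mul a (dimDerComm A k k' Δ Δ' e b))) := by
  constructor
  · intro d a b
    simp only [dimDerComm, hΔadd, hΔ'add, dcast_add]
    abel
  · intro d e a b
    simp only [dimDerComm, hΔleib, hΔ'leib, hΔadd, hΔ'add, map_dcast Δ, map_dcast Δ',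
      R.sub_mul, R.mul_sub, R.dcast_mul, R.mul_dcast, dcast_add, dcast_sub, dcast_dcast]
    abel
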